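/- Let F be a field of characteristic p > 0, let n be a natural number, and let O_n = F[x_1,…,x_n]/(x_1^p,…,x_n^p) be the truncated polynomial algebra. Let x^δ denote the image of the monomial x_1^{p-1}⋯x_n^{p-1} in O_n. Let V be a vector space over F and let M be a nonzero O_n-submodule of V ⊗_F O_n. Then M contains a nonzero element of V ⊗ F·x^δ, i.e. M ∩ (V ⊗ F·x^δ) ≠ 0. -/

import Mathlib

set_option synthInstance.maxHeartbeats 1000000

open scoped TensorProduct

/-- The truncated polynomial algebra `O_n = F[x_1, …, x_n] / (x_1^p, …, x_n^p)`. -/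
abbrev TruncPolyAlg (F : Type) [Field F] (p n : ℕ) : Type :=
  MvPolynomial (Fin n) F ⧸ Ideal.span (Set.range fun i : Fin n => (MvPolynomial.X i : MvPolynomial (Fin n) F) ^ p)

/-- The image `x^δ` of the top monomial `x_1^{p-1} ⋯ x_n^{p-1}` in `O_n`. -/
noncomputable abbrev truncTopMonomial (F : Type) [Field F] (p n : ℕ) : TruncPolyAlg F p n :=
  Ideal.Quotient.mk _ (∏ i : Fin n, (MvPolynomial.X i : MvPolynomial (Fin n) F) ^ (p - 1))

/-- A nonzero submodule contains a nonzero element annihilated by any given finite family of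
nilpotent elements of the base ring. -/
lemma Submodule.exists_ne_zero_smul_eq_zero_of_isNilpotent {R W ι : Type*} [CommRing R]
    [AddCommGroup W] [Module R W] (x : ι → R) (hx : ∀ i, IsNilpotent (x i)) (M : Submodule R W)
    (hM : M ≠ ⊥) (s : Finset ι) : ∃ w ∈ M, w ≠ 0 ∧ ∀ i ∈ s, x i • w = 0 := by
  classical
  induction s using Finset.induction_on with
  | empty =>
    obtain ⟨w, hw, h0⟩ := M.ne_bot_iff.mp hM
    exact ⟨w, hw, h0, by simp⟩
  | insert a s _ ih =>
    obtain ⟨w, hw, h0, hs⟩ := ih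
    have hex : ∃ k, x a ^ k • w = 0 := by
      obtain ⟨k, hk⟩ := hx a
      exact ⟨k, by rw [hk, zero_smul]⟩
    obtain ⟨k, hk⟩ : ∃ k, Nat.find hex = k + 1 := by
      refine Nat.exists_eq_succ_of_ne_zero fun h => h0 ?_
      simpa [h] using Nat.find_spec hex
    refine ⟨x a ^ k • w, M.smul_mem _ hw, Nat.find_min hex (by omega), fun i hi => ?_⟩
    rcases Finset.mem_insert.mp hi with rfl | hi
    · rw [smul_smul, ← pow_succ', ← hk]
      exact Nat.find_spec hex
    · rw [smul_comm, hs i hi, smul_zero]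

lemma MvPolynomial.mem_span_range_X_pow_iff {σ R : Type*} [CommSemiring R] (p : ℕ)
    (f : MvPolynomial σ R) :
    f ∈ Ideal.span (Set.range fun i : σ => (X i : MvPolynomial σ R) ^ p) ↔
      ∀ m ∈ f.support, ∃ i, p ≤ m i := by
  have h : (Set.range fun i : σ => (X i : MvPolynomial σ R) ^ p) =
      (fun s => monomial s (1 : R)) '' Set.range fun i : σ => Finsupp.single i p := by
    rw [← Set.range_comp]
    simp [Function.comp_def, X_pow_eq_monomial]
  rw [h, mem_ideal_span_monomial_image]
  simp

/-- The socle of the truncated polynomial algebra is spanned by the top monomial. -/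
lemma TruncPolyAlg.exists_eq_smul_truncTopMonomial {F : Type} [Field F] {p n : ℕ}
    (r : TruncPolyAlg F p n)
    (hr : ∀ i : Fin n, (Ideal.Quotient.mk _ (MvPolynomial.X i) : TruncPolyAlg F p n) * r = 0) :
    ∃ c : F, r = c • truncTopMonomial F p n := by
  obtain ⟨f, rfl⟩ := Ideal.Quotient.mk_surjective r
  let δ : Fin n →₀ ℕ := Finsupp.equivFunOnFinite.symm fun _ => p - 1
  have hδ : ∏ i : Fin n, (MvPolynomial.X i : MvPolynomial (Fin n) F) ^ (p - 1) =
      MvPolynomial.monomial δ 1 := by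
    rw [MvPolynomial.monomial_eq, Finsupp.prod_fintype _ _ (by simp)]
    simp [δ]
  refine ⟨f.coeff δ, ?_⟩
  rw [truncTopMonomial, hδ, ← Ideal.Quotient.mkₐ_eq_mk F, ← map_smul, Ideal.Quotient.mkₐ_eq_mk,
    Ideal.Quotient.eq, MvPolynomial.mem_span_range_X_pow_iff]
  intro m hm
  by_contra! hlt
  have hmδ : m ≠ δ := by
    rintro rfl
    simp at hm
  have hf : f.coeff m ≠ 0 := by
    simpa [MvPolynomial.coeff_monomial, hmδ.symm] using hm
  refine hmδ (Finsupp.ext fun i => ?_)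
  have hi := hr i
  rw [← map_mul, Ideal.Quotient.eq_zero_iff_mem, MvPolynomial.mem_span_range_X_pow_iff] at hi
  obtain ⟨j, hj⟩ := hi (Finsupp.single i 1 + m) (by simpa using hf)
  have hjlt := hlt j
  rw [Finsupp.add_apply, Finsupp.single_apply] at hj
  split_ifs at hj with hij
  · subst hij
    simp only [δ, Finsupp.equivFunOnFinite_symm_apply_apply]
    omega
  · omega

/-- Let `F` be a field of characteristic `p > 0` and let
`O_n = F[x_1, …, x_n]/(x_1^p, …, x_n^p)` be the truncated polynomial algebra, with `x^δ` the image
of `x_1^{p-1} ⋯ x_n^{p-1}`.  Let `V` be an `F`-vector space and let `M` be a nonzero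
`O_n`-submodule of `V ⊗_F O_n` (realised here as `O_n ⊗_F V`).  Then `M` contains a nonzero
element of `F·x^δ ⊗ V`. -/
theorem stmt_9 {F : Type} [Field F] (p : ℕ) [CharP F p] (hp : 0 < p) (n : ℕ)
    (V : Type) [AddCommGroup V] [Module F V]
    (M : Submodule (TruncPolyAlg F p n) (TruncPolyAlg F p n ⊗[F] V)) (hM : M ≠ ⊥) :
    ∃ v : V, (truncTopMonomial F p n ⊗ₜ[F] v) ∈ M ∧
      (truncTopMonomial F p n ⊗ₜ[F] v) ≠ (0 : TruncPolyAlg F p n ⊗[F] V) := by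
  obtain ⟨w, hwM, hw0, hw⟩ := M.exists_ne_zero_smul_eq_zero_of_isNilpotent
    (fun i : Fin n => (Ideal.Quotient.mk _ (MvPolynomial.X i) : TruncPolyAlg F p n))
    (fun i => ⟨p, by
      rw [← map_pow, Ideal.Quotient.eq_zero_iff_mem]
      exact Ideal.subset_span ⟨i, rfl⟩⟩) hM Finset.univ
  let b := Module.Basis.ofVectorSpace F V
  let B := b.baseChange (TruncPolyAlg F p n)
  have hr (j) : ∃ c : F, B.repr w j = c • truncTopMonomial F p n := by
    refine TruncPolyAlg.exists_eq_smul_truncTopMonomial _ fun i => ?_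
    rw [← smul_eq_mul, ← Finsupp.smul_apply, ← map_smul, hw i (Finset.mem_univ i), map_zero,
      Finsupp.zero_apply]
  choose c hc using hr
  have hwt : w = truncTopMonomial F p n ⊗ₜ[F] ∑ j ∈ (B.repr w).support, c j • b j := by
    conv_lhs => rw [← B.linearCombination_repr w, Finsupp.linearCombination_apply, Finsupp.sum]
    rw [TensorProduct.tmul_sum]
    refine Finset.sum_congr rfl fun j _ => ?_
    rw [hc, Module.Basis.baseChange_apply, TensorProduct.smul_tmul', smul_eq_mul, mul_one,
      TensorProduct.smul_tmul]
  exact ⟨_, hwt ▸ hwM, hwt ▸ hw0⟩
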